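/- For every real c with 0 < c < 1/11, set a = (4 − 11c + 7√(8c − 7c²))/32 and b = (4 − 3c − √(8c − 7c²))/32. Then the 9×9 diagonal matrix diag(a, b, b, b, b, b, b, b, c) is an extreme point of AP_{3,3}. -/

import Mathlib

open Matrix ComplexOrder

noncomputable section

/-- Index type for a two-qutrit system. -/
abbrev QIdx : Type := Fin 3 × Fin 3

/-- Partial transpose: `PT M ((i,j),(k,l)) = M ((i,l),(k,j))`. -/
def PT (M : Matrix QIdx QIdx ℂ) : Matrix QIdx QIdx ℂ :=
  fun p q => M (p.1, q.2) (q.1, p.2)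

/-- The set of absolutely PPT two-qutrit states. -/
def AP33 : Set (Matrix QIdx QIdx ℂ) :=
  {ρ | ρ.PosSemidef ∧ ρ.trace = 1 ∧
    ∀ U : Matrix QIdx QIdx ℂ, U ∈ Matrix.unitaryGroup QIdx ℂ →
      (PT (U * ρ * Uᴴ)).PosSemidef}

/-- The 9×9 diagonal matrix with prescribed real diagonal entries
(listed in order), regarded as a matrix indexed by `QIdx`. -/
def diag9 (d : Fin 9 → ℝ) : Matrix QIdx QIdx ℂ :=
  Matrix.diagonal fun p => ((d ((finProdFinEquiv.trans (finCongr (by norm_num))) p) : ℝ) : ℂ)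


/-- Singular value decomposition of a square complex matrix. -/
theorem exists_svd {n : Type*} [Fintype n] [DecidableEq n] (X : Matrix n n ℂ) :
    ∃ U ∈ unitaryGroup n ℂ, ∃ V ∈ unitaryGroup n ℂ, ∃ σ : n → ℝ, (∀ i, 0 ≤ σ i) ∧
      X = U * diagonal (fun i => (σ i : ℂ)) * Vᴴ := by
  have hH : (Xᴴ * X).IsHermitian := isHermitian_conjTranspose_mul_self X
  set V : Matrix n n ℂ := hH.eigenvectorUnitary.1
  have hVmem : V ∈ unitaryGroup n ℂ := hH.eigenvectorUnitary.2
  have hVV : V * Vᴴ = 1 := mem_unitaryGroup_iff.1 hVmem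
  set Y := X * V with hY
  have hnonneg : ∀ i, 0 ≤ hH.eigenvalues i :=
    (posSemidef_conjTranspose_mul_self X).eigenvalues_nonneg
  have hgram : Yᴴ * Y = diagonal (fun i => (hH.eigenvalues i : ℂ)) := by
    have h := hH.conjStarAlgAut_star_eigenvectorUnitary
    rw [Unitary.conjStarAlgAut_star_apply] at h
    rw [hY, conjTranspose_mul]
    simpa [Matrix.mul_assoc, star_eq_conjTranspose, Function.comp_def] using h
  set σ : n → ℝ := fun i => √(hH.eigenvalues i)
  have hσσ : ∀ i, (σ i : ℂ) * σ i = hH.eigenvalues i := fun i => by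
    rw [← Complex.ofReal_mul, Real.mul_self_sqrt (hnonneg i)]
  have hcol : ∀ i j, ∑ k, star (Y k i) * Y k j = if i = j then (σ i : ℂ) * σ i else 0 := by
    intro i j
    have := congrFun (congrFun hgram i) j
    rw [mul_apply, diagonal_apply] at this
    simpa [hσσ] using this
  let w : n → EuclideanSpace ℂ n := fun l => WithLp.toLp 2 fun k => ((σ l : ℂ))⁻¹ * Y k l
  have hw : Orthonormal ℂ ({l | σ l ≠ 0}.domRestrict w) := by
    rw [orthonormal_iff_ite]
    rintro ⟨i, hi⟩ ⟨j, hj⟩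
    have hi' : (σ i : ℂ) ≠ 0 := by simpa using hi
    have : inner ℂ (w i) (w j) = ((σ i : ℂ))⁻¹ * ((σ j : ℂ))⁻¹ * ∑ k, star (Y k i) * Y k j := by
      simp only [w, PiLp.inner_apply, RCLike.inner_apply, Finset.mul_sum]
      refine Finset.sum_congr rfl fun k _ => ?_
      simp
      ring
    change inner ℂ (w i) (w j) = _
    simp only [this, hcol, Subtype.mk.injEq]
    split_ifs with h
    · subst h
      field_simp
    · simp
  obtain ⟨e, he⟩ := hw.exists_orthonormalBasis_extension_of_card_eq (by simp)
  refine ⟨of fun k l => e l k, ?_, V, hVmem, σ, fun i => Real.sqrt_nonneg _, ?_⟩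
  · rw [mem_unitaryGroup_iff']
    ext i j
    have := orthonormal_iff_ite.1 e.orthonormal i j
    rw [PiLp.inner_apply] at this
    simpa [mul_apply, one_apply, star_eq_conjTranspose, mul_comm] using this
  · have hYe : Y = (of fun k l => e l k) * diagonal (fun i => (σ i : ℂ)) := by
      ext k l
      rw [mul_diagonal, of_apply]
      by_cases h : σ l = 0
      · have h0 := hcol l l
        simp only [h, if_true] at h0
        have h1 : ∑ k, ‖Y k l‖ ^ 2 = 0 := by
          have : ((∑ k, ‖Y k l‖ ^ 2 : ℝ) : ℂ) = 0 := by
            rw [Complex.ofReal_sum, ← mul_zero ((0 : ℝ) : ℂ)]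
            simp only [Complex.ofReal_zero] at h0 ⊢
            rw [← h0]
            refine Finset.sum_congr rfl fun k _ => ?_
            simp [Complex.conj_mul']
          exact_mod_cast this
        have h2 := (Finset.sum_eq_zero_iff_of_nonneg (fun k _ => by positivity)).1 h1 k
          (Finset.mem_univ k)
        simpa [h] using h2
      · rw [he l h]
        have : (σ l : ℂ) ≠ 0 := by simpa using h
        simp [w]
        field_simp
    rw [← hYe, hY, Matrix.mul_assoc, hVV, Matrix.mul_one]

/-- The Hermitian form of the partial transpose of a rank one projection, written in terms of the
`3 × 3` matrices `X` and `A` of coefficients of the two vectors. -/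
def ptForm (X A : Matrix (Fin 3) (Fin 3) ℂ) : ℂ :=
  ((A * Xᵀ) * (A * Xᵀ).map star).trace

theorem dotProduct_PT_vecMulVec (x u : QIdx → ℂ) :
    star x ⬝ᵥ (PT (vecMulVec u (star u)) *ᵥ x) =
      ptForm (of fun i j => x (i, j)) (of fun i j => u (i, j)) := by
  simp only [ptForm, trace, diag, mul_apply, dotProduct, mulVec, PT, vecMulVec_apply,
    Fintype.sum_prod_type, Fin.sum_univ_three, map_apply, transpose_apply, of_apply, Pi.star_apply,
    star_add, star_mul']
  ring

theorem sum_normSq_eq_trace (A : Matrix (Fin 3) (Fin 3) ℂ) :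
    ((∑ i, ∑ j, ‖A i j‖ ^ 2 : ℝ) : ℂ) = (A * Aᴴ).trace := by
  simp [trace, mul_apply, Complex.mul_conj']

theorem ptForm_svd {U V : Matrix (Fin 3) (Fin 3) ℂ} (hU : U ∈ unitaryGroup (Fin 3) ℂ)
    (hV : V ∈ unitaryGroup (Fin 3) ℂ) (σ : Fin 3 → ℝ) (A : Matrix (Fin 3) (Fin 3) ℂ) :
    ∃ G : Matrix (Fin 3) (Fin 3) ℂ, ∑ i, ∑ j, ‖G i j‖ ^ 2 = ∑ i, ∑ j, ‖A i j‖ ^ 2 ∧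
      ptForm (U * diagonal (fun i => (σ i : ℂ)) * Vᴴ) A =
        ∑ i, ∑ j, (σ i * σ j : ℂ) * (G i j * star (G j i)) := by
  have hU1 : Uᴴ * U = 1 := mem_unitaryGroup_iff'.1 hU
  have hU2 : U * Uᴴ = 1 := mem_unitaryGroup_iff.1 hU
  have hV1 : Vᴴᵀ * Vᵀ = 1 := by
    rw [← transpose_mul, show V * Vᴴ = 1 from mem_unitaryGroup_iff.1 hV, transpose_one]
  have hU3 : Uᵀ * Uᴴᵀ = 1 := by
    rw [← transpose_mul, hU1, transpose_one]
  have hmap : ∀ M : Matrix (Fin 3) (Fin 3) ℂ, M.map star = Mᴴᵀ := fun M => rfl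
  set D : Matrix (Fin 3) (Fin 3) ℂ := diagonal (fun i => (σ i : ℂ)) with hD
  set G := Uᴴ * A * Vᴴᵀ with hG
  refine ⟨G, ?_, ?_⟩
  · have : ((∑ i, ∑ j, ‖G i j‖ ^ 2 : ℝ) : ℂ) = (∑ i, ∑ j, ‖A i j‖ ^ 2 : ℝ) := by
      rw [sum_normSq_eq_trace, sum_normSq_eq_trace]
      have h1 : G * Gᴴ = Uᴴ * (A * (Vᴴᵀ * Vᵀ) * Aᴴ * U) := by
        rw [hG, conjTranspose_mul, conjTranspose_mul, conjTranspose_conjTranspose]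
        have : Vᴴᵀᴴ = Vᵀ := by
          ext i j
          simp
        simp only [this, Matrix.mul_assoc]
      rw [h1, hV1, Matrix.mul_one, trace_mul_comm, Matrix.mul_assoc, Matrix.mul_assoc, hU2,
        Matrix.mul_one]
    exact_mod_cast this
  · have hDH : Dᴴᵀ = D := by
      rw [hD, diagonal_conjTranspose, diagonal_transpose]
      congr 1
      ext i
      simp
    have hM : A * (U * D * Vᴴ)ᵀ = U * (G * D * Uᵀ) := by
      have : U * (G * D * Uᵀ) = (U * Uᴴ) * (A * Vᴴᵀ * D * Uᵀ) := by
        simp only [hG, Matrix.mul_assoc]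
      rw [this, hU2, Matrix.one_mul, transpose_mul, transpose_mul, hD, diagonal_transpose]
      simp only [Matrix.mul_assoc]
    have hM' : (A * (U * D * Vᴴ)ᵀ).map star = Uᴴᵀ * (Gᴴᵀ * D * Uᴴ) := by
      have : Uᵀᴴᵀ = Uᴴ := rfl
      rw [hM, hmap]
      simp only [conjTranspose_mul, transpose_mul, hDH, this, Matrix.mul_assoc]
    have hprod : U * (G * D * Uᵀ) * (Uᴴᵀ * (Gᴴᵀ * D * Uᴴ)) =
        U * (G * D * (Uᵀ * Uᴴᵀ) * Gᴴᵀ * D * Uᴴ) := by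
      simp only [Matrix.mul_assoc]
    rw [ptForm, hM', hM, hprod, hU3, Matrix.mul_one, trace_mul_comm, Matrix.mul_assoc, hU1,
      Matrix.mul_one]
    refine Finset.sum_congr rfl fun i _ => ?_
    rw [diag_apply, mul_diagonal, mul_apply, Finset.sum_mul]
    refine Finset.sum_congr rfl fun j _ => ?_
    rw [mul_diagonal, transpose_apply, conjTranspose_apply]
    ring

theorem exists_bound_products (σ : Fin 3 → ℝ) (hσ : ∀ i, 0 ≤ σ i) :
    ∃ p q : ℝ, 0 ≤ p ∧ 0 ≤ q ∧ p ^ 2 + q ^ 2 ≤ ∑ i, σ i ^ 2 ∧ (∀ i, σ i ≤ p) ∧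
      ∀ i j, i ≠ j → σ i * σ j ≤ p * q := by
  obtain ⟨i, hi⟩ := Finite.exists_max σ
  obtain ⟨j, hj, hjmax⟩ := (Finset.univ.erase i).exists_max_image σ
    (Finset.card_pos.1 (by simp [Finset.card_erase_of_mem]))
  have hij : i ≠ j := (Finset.ne_of_mem_erase hj).symm
  refine ⟨σ i, σ j, hσ i, hσ j, ?_, hi, fun k l hkl => ?_⟩
  · rw [← Finset.sum_pair (f := fun i => σ i ^ 2) hij]
    exact Finset.sum_le_sum_of_subset_of_nonneg (Finset.subset_univ _)
      fun _ _ _ => sq_nonneg _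
  · rcases eq_or_ne k i with rfl | hk
    · exact mul_le_mul_of_nonneg_left (hjmax l (by simp [hkl.symm])) (hσ k)
    · rw [mul_comm (σ i)]
      exact mul_le_mul (hjmax k (by simp [hk])) (hi l) (hσ l) (hσ j)

/-- Bounds for `ptForm X` in terms of the two largest singular values `p`, `q` of `X`. -/
theorem exists_ptForm_bounds (X : Matrix (Fin 3) (Fin 3) ℂ) :
    ∃ p q : ℝ, p ^ 2 + q ^ 2 ≤ ∑ i, ∑ j, ‖X i j‖ ^ 2 ∧
      ∀ A : Matrix (Fin 3) (Fin 3) ℂ,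
        -(p * q) * ∑ i, ∑ j, ‖A i j‖ ^ 2 ≤ (ptForm X A).re ∧
        (ptForm X A).re ≤ p ^ 2 * ∑ i, ∑ j, ‖A i j‖ ^ 2 := by
  obtain ⟨U, hU, V, hV, σ, hσ, rfl⟩ := exists_svd X
  obtain ⟨p, q, hp, hq, hpq, hle, hprod⟩ := exists_bound_products σ hσ
  have hnorm : ∑ i, ∑ j, ‖(U * diagonal (fun i => (σ i : ℂ)) * Vᴴ) i j‖ ^ 2 = ∑ i, σ i ^ 2 := by
    have : ((∑ i, ∑ j, ‖(U * diagonal (fun i => (σ i : ℂ)) * Vᴴ) i j‖ ^ 2 : ℝ) : ℂ) =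
        (∑ i, σ i ^ 2 : ℝ) := by
      have h1 : ∀ D : Matrix (Fin 3) (Fin 3) ℂ,
          (U * D * Vᴴ) * (U * D * Vᴴ)ᴴ = U * (D * (Vᴴ * V) * Dᴴ * Uᴴ) := fun D => by
        simp only [conjTranspose_mul, conjTranspose_conjTranspose, Matrix.mul_assoc]
      rw [sum_normSq_eq_trace, h1, show Vᴴ * V = 1 from mem_unitaryGroup_iff'.1 hV, Matrix.mul_one,
        trace_mul_comm, Matrix.mul_assoc, show Uᴴ * U = 1 from mem_unitaryGroup_iff'.1 hU,
        Matrix.mul_one]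
      simp [trace, diagonal_conjTranspose, sq]
    exact_mod_cast this
  refine ⟨p, q, hnorm ▸ hpq, fun A => ?_⟩
  obtain ⟨G, hG, hform⟩ := ptForm_svd hU hV σ A
  rw [hform, ← hG]
  have hpq' : 0 ≤ p * q := mul_nonneg hp hq
  have hterm : ∀ i j, |(G i j * star (G j i)).re| ≤ (‖G i j‖ ^ 2 + ‖G j i‖ ^ 2) / 2 := by
    intro i j
    have h := Complex.abs_re_le_norm (G i j * star (G j i))
    rw [norm_mul, norm_star] at h
    nlinarith [sq_nonneg (‖G i j‖ - ‖G j i‖)]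
  have hre : (∑ i, ∑ j, (σ i * σ j : ℂ) * (G i j * star (G j i))).re =
      ∑ i, ∑ j, (σ i * σ j) * (G i j * star (G j i)).re := by
    simp only [Complex.re_sum, ← Complex.ofReal_mul, Complex.re_ofReal_mul]
  have hsum : ∀ c : ℝ, ∑ i, ∑ j, c * ((‖G i j‖ ^ 2 + ‖G j i‖ ^ 2) / 2) =
      c * ∑ i, ∑ j, ‖G i j‖ ^ 2 := by
    intro c
    simp only [Fin.sum_univ_three]
    ring
  rw [hre, ← hsum, ← hsum]
  constructor
  · refine Finset.sum_le_sum fun i _ => Finset.sum_le_sum fun j _ => ?_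
    rcases eq_or_ne i j with rfl | hij
    · have : (G i i * star (G i i)).re = ‖G i i‖ ^ 2 := by
        rw [Complex.star_def, Complex.mul_conj']
        exact_mod_cast Complex.ofReal_re _
      rw [this]
      nlinarith [mul_nonneg hpq' (sq_nonneg ‖G i i‖),
        mul_nonneg (mul_self_nonneg (σ i)) (sq_nonneg ‖G i i‖)]
    · nlinarith [hprod i j hij, mul_nonneg (hσ i) (hσ j), hterm i j, abs_le.1 (hterm i j),
        abs_nonneg (G i j * star (G j i)).re, neg_abs_le (G i j * star (G j i)).re,
        mul_le_mul (hprod i j hij) (hterm i j) (abs_nonneg _) hpq',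
        mul_le_mul_of_nonneg_left (neg_abs_le (G i j * star (G j i)).re)
          (mul_nonneg (hσ i) (hσ j))]
  · refine Finset.sum_le_sum fun i _ => Finset.sum_le_sum fun j _ => ?_
    have h1 : σ i * σ j ≤ p ^ 2 := by
      rw [sq]
      exact mul_le_mul (hle i) (hle j) (hσ j) hp
    have h2 := mul_le_mul h1 (hterm i j) (abs_nonneg _) (sq_nonneg p)
    have h3 := mul_le_mul_of_nonneg_left (le_abs_self (G i j * star (G j i)).re)
      (mul_nonneg (hσ i) (hσ j))
    linarith

/-- The diagonal matrix with entry `a` at `(0, 0)`, `c` at `(2, 2)` and `b` elsewhere. -/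
def threeLevel (a b c : ℝ) : Matrix QIdx QIdx ℂ :=
  diagonal fun p => if p = (0, 0) then (a : ℂ) else if p = (2, 2) then (c : ℂ) else (b : ℂ)

theorem diag9_eq_threeLevel (a b c : ℝ) :
    diag9 ![a, b, b, b, b, b, b, b, c] = threeLevel a b c := by
  unfold diag9 threeLevel
  congr 1
  ext p
  fin_cases p <;> simp [finProdFinEquiv]

theorem threeLevel_eq (a b c : ℝ) : threeLevel a b c = (b : ℂ) • (1 : Matrix QIdx QIdx ℂ) +
    ((a - b : ℝ) : ℂ) • vecMulVec (Pi.single (0, 0) 1) (Pi.single (0, 0) 1) -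
    ((b - c : ℝ) : ℂ) • vecMulVec (Pi.single (2, 2) 1) (Pi.single (2, 2) 1) := by
  ext s t
  simp only [threeLevel, diagonal_apply, Matrix.add_apply, Matrix.sub_apply, Matrix.smul_apply,
    vecMulVec_apply, Pi.single_apply, one_apply, smul_eq_mul]
  by_cases hst : s = t
  · subst hst
    by_cases h0 : s = (0, 0)
    · simp [h0]
    · by_cases h2 : s = (2, 2) <;> simp [h0, h2]
  · by_cases h0 : s = (0, 0) <;> by_cases h2 : s = (2, 2) <;> by_cases h0' : t = (0, 0) <;>
      by_cases h2' : t = (2, 2) <;> simp_all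

theorem conj_threeLevel {U : Matrix QIdx QIdx ℂ} (hU : U ∈ unitaryGroup QIdx ℂ) (a b c : ℝ) :
    U * threeLevel a b c * Uᴴ = (b : ℂ) • (1 : Matrix QIdx QIdx ℂ) +
      ((a - b : ℝ) : ℂ) • vecMulVec (U.col (0, 0)) (star (U.col (0, 0))) -
      ((b - c : ℝ) : ℂ) • vecMulVec (U.col (2, 2)) (star (U.col (2, 2))) := by
  have hv : ∀ i : QIdx, U * vecMulVec (Pi.single i 1) (Pi.single i 1) * Uᴴ =
      vecMulVec (U.col i) (star (U.col i)) := by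
    intro i
    rw [mul_vecMulVec, vecMulVec_mul, mulVec_single_one, single_one_vecMul]
    rfl
  rw [threeLevel_eq, Matrix.mul_sub, Matrix.mul_add, Matrix.sub_mul, Matrix.add_mul,
    Matrix.mul_smul, Matrix.mul_smul, Matrix.mul_smul, Matrix.smul_mul, Matrix.smul_mul,
    Matrix.smul_mul, hv, hv, Matrix.mul_one, show U * Uᴴ = 1 from mem_unitaryGroup_iff.1 hU]

theorem PT_isHermitian {M : Matrix QIdx QIdx ℂ} (hM : M.IsHermitian) : (PT M).IsHermitian :=
  IsHermitian.ext fun _ _ => hM.apply _ _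

theorem sum_normSq_col {U : Matrix QIdx QIdx ℂ} (hU : U ∈ unitaryGroup QIdx ℂ) (m : QIdx) :
    ∑ i, ∑ j, ‖(of fun i j => U.col m (i, j) : Matrix (Fin 3) (Fin 3) ℂ) i j‖ ^ 2 = 1 := by
  have h := congrFun (congrFun (mem_unitaryGroup_iff'.1 hU) m) m
  rw [mul_apply, one_apply_eq, Fintype.sum_prod_type] at h
  have h' : ((∑ i, ∑ j, ‖U (i, j) m‖ ^ 2 : ℝ) : ℂ) = 1 := by
    rw [← h]
    push_cast
    refine Finset.sum_congr rfl fun i _ => Finset.sum_congr rfl fun j _ => ?_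
    rw [star_apply, Complex.star_def, Complex.conj_mul']
  simpa using (by exact_mod_cast h' : ∑ i, ∑ j, ‖U (i, j) m‖ ^ 2 = 1)

/-- A three-level state with a simple largest and a simple smallest eigenvalue is absolutely PPT
as soon as `(a - b) ^ 2 ≤ 4 * b * c`. -/
theorem threeLevel_mem_AP33 {a b c : ℝ} (hc : 0 ≤ c) (hcb : c ≤ b) (hba : b ≤ a)
    (htr : a + 7 * b + c = 1) (hdisc : (a - b) ^ 2 ≤ 4 * b * c) : threeLevel a b c ∈ AP33 := by
  have hpsd : (threeLevel a b c).PosSemidef := by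
    refine PosSemidef.diagonal fun p => ?_
    simp only [Pi.zero_apply]
    split_ifs <;> rw [Complex.zero_le_real] <;> linarith
  refine ⟨hpsd, ?_, fun U hU => ?_⟩
  · have : ((a + 7 * b + c : ℝ) : ℂ) = 1 := by rw [htr, Complex.ofReal_one]
    rw [← this]
    simp [threeLevel, trace, Fintype.sum_prod_type, Fin.sum_univ_three, Prod.ext_iff]
    ring
  have hherm := PT_isHermitian (hpsd.mul_mul_conjTranspose_same U).isHermitian
  refine PosSemidef.of_dotProduct_mulVec_nonneg hherm fun x => ?_
  have him := hherm.im_star_dotProduct_mulVec_self x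
  rw [Complex.nonneg_iff]
  refine ⟨?_, him.symm⟩
  obtain ⟨p, q, hpq, hbound⟩ := exists_ptForm_bounds (of fun i j => x (i, j))
  have hu := (hbound (of fun i j => U.col (0, 0) (i, j))).1
  have hv := (hbound (of fun i j => U.col (2, 2) (i, j))).2
  rw [sum_normSq_col hU] at hu hv
  have hPT : PT (U * threeLevel a b c * Uᴴ) = (b : ℂ) • (1 : Matrix QIdx QIdx ℂ) +
      ((a - b : ℝ) : ℂ) • PT (vecMulVec (U.col (0, 0)) (star (U.col (0, 0)))) -
      ((b - c : ℝ) : ℂ) • PT (vecMulVec (U.col (2, 2)) (star (U.col (2, 2)))) := by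
    rw [conj_threeLevel hU]
    ext s t
    simp only [PT, Matrix.add_apply, Matrix.sub_apply, Matrix.smul_apply, one_apply, Prod.ext_iff]
    congr 4
    rw [eq_iff_iff]
    tauto
  have hnorm : star x ⬝ᵥ x =
      ((∑ i, ∑ j, ‖(of fun i j => x (i, j) : Matrix (Fin 3) (Fin 3) ℂ) i j‖ ^ 2 : ℝ) : ℂ) := by
    simp only [dotProduct, Fintype.sum_prod_type, Pi.star_apply, Complex.star_def,
      Complex.conj_mul', of_apply, Complex.ofReal_sum, Complex.ofReal_pow]
  rw [hPT, sub_mulVec, add_mulVec, smul_mulVec, smul_mulVec, smul_mulVec, one_mulVec,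
    dotProduct_sub, dotProduct_add, dotProduct_smul, dotProduct_smul, dotProduct_smul,
    dotProduct_PT_vecMulVec, dotProduct_PT_vecMulVec, hnorm]
  simp only [smul_eq_mul, Complex.sub_re, Complex.add_re, Complex.re_ofReal_mul,
    Complex.ofReal_re]
  set S := ∑ i, ∑ j, ‖(of fun i j => x (i, j) : Matrix (Fin 3) (Fin 3) ℂ) i j‖ ^ 2
  have hb : 0 ≤ b := hc.trans hcb
  have hquad : 0 ≤ c * p ^ 2 - (a - b) * (p * q) + b * q ^ 2 := by
    rcases hb.eq_or_lt with hb0 | hb0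
    · have hc0 : c = 0 := le_antisymm (hb0 ▸ hcb) hc
      have : a - b = 0 := by
        rw [hc0, mul_zero] at hdisc
        exact pow_eq_zero_iff two_ne_zero |>.1 (le_antisymm hdisc (sq_nonneg _))
      rw [hc0, this, ← hb0]
      simp
    · have : 0 ≤ 4 * b * (c * p ^ 2 - (a - b) * (p * q) + b * q ^ 2) := by
        nlinarith [sq_nonneg ((a - b) * p - 2 * b * q),
          mul_nonneg (sub_nonneg.2 hdisc) (sq_nonneg p)]
      exact nonneg_of_mul_nonneg_right this (by positivity)
  nlinarith [mul_le_mul_of_nonneg_left hpq hb, mul_le_mul_of_nonneg_left hu (sub_nonneg.2 hba),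
    mul_le_mul_of_nonneg_left hv (sub_nonneg.2 hcb)]

/-- The rotation by `π / 4` in the plane spanned by the basis vectors `(0, 1)` and `(1, 0)`. -/
def planeRotation : Matrix QIdx QIdx ℂ := fun s t =>
  if s = (0, 1) then
    if t = (0, 1) then ((√2)⁻¹ : ℝ) else if t = (1, 0) then ((√2)⁻¹ : ℝ) else 0
  else if s = (1, 0) then
    if t = (0, 1) then -((√2)⁻¹ : ℝ) else if t = (1, 0) then ((√2)⁻¹ : ℝ) else 0
  else if s = t then 1 else 0

theorem inv_sqrt_two_mul_self : (((√2)⁻¹ : ℝ) : ℂ) * ((√2)⁻¹ : ℝ) = 1 / 2 := by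
  rw [← Complex.ofReal_mul, ← mul_inv, Real.mul_self_sqrt zero_le_two]
  simp

theorem planeRotation_mem : planeRotation ∈ unitaryGroup QIdx ℂ := by
  have hk := inv_sqrt_two_mul_self
  rw [mem_unitaryGroup_iff]
  generalize hkk : (((√2)⁻¹ : ℝ) : ℂ) = k at hk
  have hstar : star k = k := by rw [← hkk]; simp
  have hstar' : (starRingEnd ℂ) k = k := hstar
  ext s t
  simp only [mul_apply, star_apply, planeRotation, hkk]
  fin_cases s <;> fin_cases t <;>
    simp [Fintype.sum_prod_type, Fin.sum_univ_three, Prod.ext_iff, hstar', hk] <;> norm_num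

/-- The monomial matrix sending `s` to `e s` times the basis covector `π s`. -/
def monomial (π : Equiv.Perm QIdx) (e : QIdx → ℝ) : Matrix QIdx QIdx ℂ :=
  fun s t => if π s = t then (e s : ℂ) else 0

theorem monomial_conj_apply (π : Equiv.Perm QIdx) (e : QIdx → ℝ) (r : Matrix QIdx QIdx ℂ)
    (s t : QIdx) :
    (monomial π e * r * (monomial π e)ᴴ) s t = (e s * e t : ℂ) * r (π s) (π t) := by
  simp only [mul_apply, monomial, conjTranspose_apply, apply_ite star, star_zero, ite_mul, mul_ite,
    zero_mul, mul_zero, Finset.sum_ite_eq, Finset.mem_univ, if_true]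
  simp
  ring

theorem monomial_mem (π : Equiv.Perm QIdx) {e : QIdx → ℝ} (he : ∀ s, e s * e s = 1) :
    monomial π e ∈ unitaryGroup QIdx ℂ := by
  rw [mem_unitaryGroup_iff]
  ext s t
  have h := monomial_conj_apply π e 1 s t
  rw [Matrix.mul_one] at h
  rw [star_eq_conjTranspose, h, one_apply, one_apply]
  by_cases hst : s = t
  · subst hst
    simp [← Complex.ofReal_mul, he]
  · simp [hst]

/-- The vector `p e₀₀ + q e₁₁`. -/
def schmidtVec (p q : ℝ) : QIdx → ℂ :=
  fun s => if s = (0, 0) then (p : ℂ) else if s = (1, 1) then (q : ℂ) else 0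

theorem PT_mulVec_schmidtVec (M : Matrix QIdx QIdx ℂ) (p q : ℝ) (i j : Fin 3) :
    (PT M *ᵥ schmidtVec p q) (i, j) = M (i, 0) (0, j) * p + M (i, 1) (1, j) * q := by
  simp [mulVec, dotProduct, PT, schmidtVec, Fintype.sum_prod_type, Fin.sum_univ_three,
    Prod.ext_iff]

theorem dotProduct_schmidtVec (p q : ℝ) (y : QIdx → ℂ) :
    star (schmidtVec p q) ⬝ᵥ y = p * y (0, 0) + q * y (1, 1) := by
  simp [dotProduct, schmidtVec, Fintype.sum_prod_type, Fin.sum_univ_three, Prod.ext_iff]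

section planeRotation

variable (N : Matrix QIdx QIdx ℂ) (p q : ℝ)

theorem PT_planeRotation_00 :
    (PT (planeRotation * N * planeRotationᴴ) *ᵥ schmidtVec p q) (0, 0) = N (0, 0) (0, 0) * p +
      (N (0, 1) (1, 0) - N (1, 0) (0, 1) + N (1, 0) (1, 0) - N (0, 1) (0, 1)) / 2 * q := by
  have hk := inv_sqrt_two_mul_self
  rw [PT_mulVec_schmidtVec]
  simp only [mul_apply, conjTranspose_apply, planeRotation, Fintype.sum_prod_type,
    Fin.sum_univ_three, Prod.ext_iff]
  simp only [Complex.ofReal_inv] at hk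
  simp
  left
  linear_combination
    (N (0, 1) (1, 0) - N (1, 0) (0, 1) + N (1, 0) (1, 0) - N (0, 1) (0, 1)) * hk

theorem PT_planeRotation_11 :
    (PT (planeRotation * N * planeRotationᴴ) *ᵥ schmidtVec p q) (1, 1) =
      (N (1, 0) (0, 1) - N (0, 1) (1, 0) + N (1, 0) (1, 0) - N (0, 1) (0, 1)) / 2 * p +
        N (1, 1) (1, 1) * q := by
  have hk := inv_sqrt_two_mul_self
  rw [PT_mulVec_schmidtVec]
  simp only [mul_apply, conjTranspose_apply, planeRotation, Fintype.sum_prod_type,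
    Fin.sum_univ_three, Prod.ext_iff]
  simp only [Complex.ofReal_inv] at hk
  simp
  left
  linear_combination
    (N (1, 0) (0, 1) - N (0, 1) (1, 0) + N (1, 0) (1, 0) - N (0, 1) (0, 1)) * hk

theorem PT_planeRotation_01 :
    (PT (planeRotation * N * planeRotationᴴ) *ᵥ schmidtVec p q) (0, 1) = ((√2)⁻¹ : ℝ) *
      ((N (0, 0) (0, 1) + N (0, 0) (1, 0)) * p + (N (0, 1) (1, 1) + N (1, 0) (1, 1)) * q) := by
  rw [PT_mulVec_schmidtVec]
  simp only [mul_apply, conjTranspose_apply, planeRotation, Fintype.sum_prod_type,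
    Fin.sum_univ_three, Prod.ext_iff]
  simp
  ring

theorem PT_planeRotation_20 :
    (PT (planeRotation * N * planeRotationᴴ) *ᵥ schmidtVec p q) (2, 0) =
      N (2, 0) (0, 0) * p + ((√2)⁻¹ : ℝ) * (N (2, 1) (1, 0) - N (2, 1) (0, 1)) * q := by
  rw [PT_mulVec_schmidtVec]
  simp only [mul_apply, conjTranspose_apply, planeRotation, Fintype.sum_prod_type,
    Fin.sum_univ_three, Prod.ext_iff]
  simp
  left
  ring

end planeRotation

theorem PT_mulVec_eq_zero_of_mem_openSegment {ρ r r' : Matrix QIdx QIdx ℂ} (hr : r ∈ AP33)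
    (hr' : r' ∈ AP33) (hρ : ρ ∈ openSegment ℝ r r') {U : Matrix QIdx QIdx ℂ}
    (hU : U ∈ unitaryGroup QIdx ℂ) {x : QIdx → ℂ}
    (hx : star x ⬝ᵥ (PT (U * ρ * Uᴴ) *ᵥ x) = 0) : PT (U * r * Uᴴ) *ᵥ x = 0 := by
  obtain ⟨α, β, hα, hβ, -, rfl⟩ := hρ
  have h1 := hr.2.2 U hU
  have h2 := (hr'.2.2 U hU).dotProduct_mulVec_nonneg x
  have hPT : PT (U * (α • r + β • r') * Uᴴ) =
      α • PT (U * r * Uᴴ) + β • PT (U * r' * Uᴴ) := by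
    rw [Matrix.mul_add, Matrix.add_mul, Matrix.mul_smul, Matrix.mul_smul, Matrix.smul_mul,
      Matrix.smul_mul]
    rfl
  rw [hPT, add_mulVec, smul_mulVec, smul_mulVec, dotProduct_add, dotProduct_smul,
    dotProduct_smul] at hx
  rw [← h1.dotProduct_mulVec_zero_iff]
  have h1' := h1.dotProduct_mulVec_nonneg x
  have := (add_eq_zero_iff_of_nonneg (smul_nonneg hα.le h1') (smul_nonneg hβ.le h2)).1 hx
  exact (smul_eq_zero.1 this.1).resolve_left hα.ne'

theorem threeLevel_kernel {a b c : ℝ} (hdisc : (a - b) ^ 2 = 4 * b * c)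
    {r r' : Matrix QIdx QIdx ℂ} (hr : r ∈ AP33) (hr' : r' ∈ AP33)
    (hρ : threeLevel a b c ∈ openSegment ℝ r r') {π : Equiv.Perm QIdx} (hπ0 : π (0, 0) = (2, 2))
    (hπ1 : π (0, 1) = (0, 0)) {e : QIdx → ℝ}
    (he : ∀ s, e s * e s = 1) :
    PT (planeRotation * (monomial π e * r * (monomial π e)ᴴ) * planeRotationᴴ) *ᵥ
      schmidtVec (2 * b) (a - b) = 0 := by
  have hassoc : ∀ M : Matrix QIdx QIdx ℂ,
      planeRotation * (monomial π e * M * (monomial π e)ᴴ) * planeRotationᴴ =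
        (planeRotation * monomial π e) * M * (planeRotation * monomial π e)ᴴ := fun M => by
    simp only [conjTranspose_mul, Matrix.mul_assoc]
  rw [hassoc]
  refine PT_mulVec_eq_zero_of_mem_openSegment hr hr' hρ
    (mul_mem planeRotation_mem (monomial_mem π he)) ?_
  rw [← hassoc, dotProduct_schmidtVec, PT_planeRotation_00, PT_planeRotation_11]
  have hne : ∀ s : QIdx, s ≠ (0, 0) → π s ≠ (2, 2) := fun s hs h =>
    hs (π.injective (h.trans hπ0.symm))
  have hne' : ∀ s : QIdx, s ≠ (0, 1) → π s ≠ (0, 0) := fun s hs h =>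
    hs (π.injective (h.trans hπ1.symm))
  have he' : ∀ s, (e s * e s : ℂ) = 1 := fun s => by exact_mod_cast he s
  have hd : ((a : ℂ) - b) ^ 2 = 4 * b * c := by exact_mod_cast hdisc
  have h10 : π (1, 0) ≠ (0, 0) := hne' _ (by decide)
  have h10' : π (1, 0) ≠ (2, 2) := hne _ (by decide)
  have h11 : π (1, 1) ≠ (0, 0) := hne' _ (by decide)
  have h11' : π (1, 1) ≠ (2, 2) := hne _ (by decide)
  simp only [monomial_conj_apply, threeLevel, diagonal_apply, hπ0, hπ1, h10, h10', h11,
    h11', h10.symm, he', if_true, if_false]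
  have h20 : ((2, 2) : QIdx) ≠ (0, 0) := by decide
  simp only [h20, if_false]
  push_cast
  linear_combination (-(b : ℂ)) * hd

/-- A permutation taking `(0, 0)`, `(0, 1)` to `(2, 2)`, `(0, 0)`. -/
def basePerm : Equiv.Perm QIdx :=
  Equiv.swap (0, 0) (2, 2) * Equiv.swap (0, 1) (2, 2)

theorem exists_perm {s t h g : QIdx} (hs : s ≠ (0, 0) ∧ s ≠ (0, 1)) (ht : t ≠ (0, 0) ∧ t ≠ (0, 1))
    (hst : s ≠ t) (hh : h ≠ (0, 0) ∧ h ≠ (2, 2)) (hg : g ≠ (0, 0) ∧ g ≠ (2, 2)) (hhg : h ≠ g) :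
    ∃ π : Equiv.Perm QIdx, π (0, 0) = (2, 2) ∧ π (0, 1) = (0, 0) ∧ π s = h ∧ π t = g := by
  have hb0 : basePerm (0, 0) = (2, 2) := by decide
  have hb1 : basePerm (0, 1) = (0, 0) := by decide
  have key : ∀ (τ : Equiv.Perm QIdx) (u v : QIdx), τ (0, 0) = (2, 2) → τ (0, 1) = (0, 0) →
      u ≠ (0, 0) ∧ u ≠ (0, 1) → v ≠ (0, 0) ∧ v ≠ (2, 2) →
      (Equiv.swap v (τ u) * τ) (0, 0) = (2, 2) ∧ (Equiv.swap v (τ u) * τ) (0, 1) = (0, 0) ∧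
        (Equiv.swap v (τ u) * τ) u = v := by
    intro τ u v h0 h1 hu hv
    refine ⟨?_, ?_, ?_⟩
    · rw [Equiv.Perm.mul_apply, h0, Equiv.swap_apply_of_ne_of_ne hv.2.symm]
      rw [← h0]
      exact fun h => hu.1 (τ.injective h).symm
    · rw [Equiv.Perm.mul_apply, h1, Equiv.swap_apply_of_ne_of_ne hv.1.symm]
      rw [← h1]
      exact fun h => hu.2 (τ.injective h).symm
    · rw [Equiv.Perm.mul_apply, Equiv.swap_apply_right]
  obtain ⟨k0, k1, k2⟩ := key basePerm s h hb0 hb1 hs hh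
  set τ := Equiv.swap h (basePerm s) * basePerm
  obtain ⟨l0, l1, l2⟩ := key τ t g k0 k1 ht hg
  refine ⟨_, l0, l1, ?_, l2⟩
  rw [Equiv.Perm.mul_apply, k2, Equiv.swap_apply_of_ne_of_ne hhg]
  rw [← k2]
  exact fun h => hst (τ.injective h)

/-- The sign vector flipping the single index `u`. -/
def signFlip (u : QIdx) : QIdx → ℝ := fun s => if s = u then -1 else 1

theorem signFlip_mul_self (u s : QIdx) : signFlip u s * signFlip u s = 1 := by
  unfold signFlip
  split_ifs <;> norm_num

theorem eq_threeLevel_of_mem_openSegment {a b c : ℝ} (hb : 0 < b) (hab : b < a)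
    (htr : a + 7 * b + c = 1) (hdisc : (a - b) ^ 2 = 4 * b * c) {r r' : Matrix QIdx QIdx ℂ}
    (hr : r ∈ AP33) (hr' : r' ∈ AP33) (hρ : threeLevel a b c ∈ openSegment ℝ r r') :
    r = threeLevel a b c := by
  have hker : ∀ π : Equiv.Perm QIdx, π (0, 0) = (2, 2) → π (0, 1) = (0, 0) → ∀ e : QIdx → ℝ,
      (∀ s, e s * e s = 1) → ∀ i j,
      (PT (planeRotation * (monomial π e * r * (monomial π e)ᴴ) * planeRotationᴴ) *ᵥ
        schmidtVec (2 * b) (a - b)) (i, j) = 0 := fun π h0 h1 e he i j => by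
    rw [threeLevel_kernel hdisc hr hr' hρ h0 h1 he, Pi.zero_apply]
  have hb0 : (b : ℂ) ≠ 0 := by exact_mod_cast hb.ne'
  have hab' : (a : ℂ) - b ≠ 0 := by exact_mod_cast sub_ne_zero.2 hab.ne'
  have hsymm : ∀ s t, r s t = 0 → r t s = 0 := fun s t h => by
    rw [← hr.1.isHermitian.apply t s, h, star_zero]
  have hother : ∀ h : QIdx, ∃ g : QIdx, (g ≠ (0, 0) ∧ g ≠ (2, 2)) ∧ h ≠ g := fun h => by
    by_cases h1 : h = (1, 1)
    · exact ⟨(1, 0), by decide, by rw [h1]; decide⟩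
    · exact ⟨(1, 1), by decide, h1⟩
  have hC : ∀ h : QIdx, h ≠ (0, 0) ∧ h ≠ (2, 2) → r h (2, 2) = 0 := by
    intro h hh
    obtain ⟨g, hg, hhg⟩ := hother h
    obtain ⟨π, h0, h1, h2, -⟩ := exists_perm (s := (2, 0)) (t := (1, 1)) (by decide) (by decide)
      (by decide) hh hg hhg
    have e1 := hker π h0 h1 1 (by simp) 2 0
    have e2 := hker π h0 h1 (signFlip (2, 0)) (signFlip_mul_self _) 2 0
    simp only [PT_planeRotation_20, monomial_conj_apply, h0, h1, h2] at e1 e2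
    simp [signFlip] at e1 e2
    exact mul_right_cancel₀ hb0 (by linear_combination (e1 - e2) / 4)
  have hmid : ∀ h g : QIdx, h ≠ (0, 0) ∧ h ≠ (2, 2) → g ≠ (0, 0) ∧ g ≠ (2, 2) → h ≠ g →
      r h g = 0 ∧ r h (0, 0) = 0 := by
    intro h g hh hg hhg
    obtain ⟨π, h0, h1, h2, h3⟩ := exists_perm (s := (2, 1)) (t := (1, 0)) (by decide) (by decide)
      (by decide) hh hg hhg
    have e1 := hker π h0 h1 1 (by simp) 2 0
    have e2 := hker π h0 h1 (signFlip (1, 0)) (signFlip_mul_self _) 2 0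
    have e3 : r (π (2, 0)) (2, 2) = 0 := hC _
      ⟨fun h => absurd (π.injective (h.trans h1.symm)) (by decide),
      fun h => absurd (π.injective (h.trans h0.symm)) (by decide)⟩
    simp only [PT_planeRotation_20, monomial_conj_apply, h0, h1, h2, h3, e3] at e1 e2
    simp [signFlip] at e1 e2
    have f1 := e1.resolve_right hab'
    have f2 := e2.resolve_right hab'
    exact ⟨by linear_combination (f1 - f2) / 2, by linear_combination -(f1 + f2) / 2⟩
  have hAC : r (2, 2) (0, 0) = 0 := by
    obtain ⟨π, h0, h1, h2, h3⟩ := exists_perm (s := (1, 0)) (t := (1, 1)) (h := (1, 0))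
      (g := (1, 1)) (by decide) (by decide) (by decide) (by decide) (by decide) (by decide)
    have e1 := hker π h0 h1 1 (by simp) 0 1
    have e3 := hsymm _ _ (hC (1, 0) (by decide))
    have e4 := hsymm _ _ (hmid (1, 1) (1, 0) (by decide) (by decide) (by decide)).1
    have e5 := hsymm _ _ (hmid (1, 1) (1, 0) (by decide) (by decide) (by decide)).2
    simp only [PT_planeRotation_01, monomial_conj_apply, h0, h1, h2, h3, e3, e4, e5] at e1
    simp at e1
    exact e1.resolve_right hb.ne'
  have hdiag : ∀ h g : QIdx, h ≠ (0, 0) ∧ h ≠ (2, 2) → g ≠ (0, 0) ∧ g ≠ (2, 2) → h ≠ g →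
      r (2, 2) (2, 2) * (2 * b) + (r g g - r (0, 0) (0, 0)) / 2 * (a - b) = 0 ∧
      (r g g - r (0, 0) (0, 0)) / 2 * (2 * b) + r h h * (a - b) = 0 := by
    intro h g hh hg hhg
    obtain ⟨π, h0, h1, h2, h3⟩ := exists_perm (s := (1, 1)) (t := (1, 0)) (by decide) (by decide)
      (by decide) hh hg hhg
    have e0 := hker π h0 h1 1 (by simp) 0 0
    have e1 := hker π h0 h1 1 (by simp) 1 1
    have e4 := (hmid g h hg hh hhg.symm).2
    have e5 := hsymm _ _ e4
    simp only [PT_planeRotation_00, PT_planeRotation_11, monomial_conj_apply, h0, h1, h2, h3,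
      e4, e5] at e0 e1
    simp at e0 e1
    exact ⟨e0, e1⟩
  have hconst : ∀ g : QIdx, g ≠ (0, 0) ∧ g ≠ (2, 2) → r g g = r (1, 1) (1, 1) := by
    intro g hg
    obtain ⟨h, hh, hhg⟩ := hother g
    have e0 := (hdiag h g hh hg hhg.symm).1
    have e1 := (hdiag (1, 0) (1, 1) (by decide) (by decide) (by decide)).1
    exact mul_right_cancel₀ hab' (by linear_combination 2 * e0 - 2 * e1)
  obtain ⟨e0, e1⟩ := hdiag (1, 0) (1, 1) (by decide) (by decide) (by decide)
  rw [hconst (1, 0) (by decide)] at e1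
  have htrace : r (0, 0) (0, 0) + 7 * r (1, 1) (1, 1) + r (2, 2) (2, 2) = 1 := by
    rw [← hr.2.1, trace, Fintype.sum_prod_type]
    simp only [Fin.sum_univ_three, diag_apply, hconst (0, 1) (by decide), hconst (0, 2) (by decide),
      hconst (1, 0) (by decide), hconst (1, 2) (by decide), hconst (2, 0) (by decide),
      hconst (2, 1) (by decide)]
    ring
  have hd : ((a : ℂ) - b) ^ 2 = 4 * b * c := by exact_mod_cast hdisc
  have ht : (a : ℂ) + 7 * b + c = 1 := by exact_mod_cast htr
  have hα : (b : ℂ) * r (0, 0) (0, 0) = a * r (1, 1) (1, 1) := by linear_combination -e1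
  have hγ : (b : ℂ) * r (2, 2) (2, 2) = c * r (1, 1) (1, 1) := by
    refine mul_left_cancel₀ hb0 (mul_left_cancel₀ (four_ne_zero) ?_)
    linear_combination 2 * b * e0 - (a - b) * e1 + r (1, 1) (1, 1) * hd
  have hβ : r (1, 1) (1, 1) = b := by
    linear_combination b * htrace - hα - hγ - r (1, 1) (1, 1) * ht
  have hα' : r (0, 0) (0, 0) = a := mul_left_cancel₀ hb0 (by rw [hα, hβ, mul_comm])
  have hγ' : r (2, 2) (2, 2) = c := mul_left_cancel₀ hb0 (by rw [hγ, hβ, mul_comm])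
  ext s t
  rw [threeLevel, diagonal_apply]
  have hoff : ∀ h : QIdx, h ≠ (0, 0) ∧ h ≠ (2, 2) → r h (0, 0) = 0 := fun h hh => by
    obtain ⟨g, hg, hhg⟩ := hother h
    exact (hmid h g hh hg hhg).2
  by_cases hs0 : s = (0, 0)
  · subst hs0
    by_cases ht0 : t = (0, 0)
    · simp [ht0, hα']
    by_cases ht2 : t = (2, 2)
    · subst ht2
      simp [hsymm _ _ hAC]
    · simp [hsymm _ _ (hoff t ⟨ht0, ht2⟩), Ne.symm ht0]
  by_cases hs2 : s = (2, 2)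
  · subst hs2
    by_cases ht0 : t = (0, 0)
    · simp [ht0, hAC]
    by_cases ht2 : t = (2, 2)
    · simp [ht2, hγ']
    · simp [hsymm _ _ (hC t ⟨ht0, ht2⟩), Ne.symm ht2]
  by_cases ht0 : t = (0, 0)
  · subst ht0
    simp [hs0, hoff s ⟨hs0, hs2⟩]
  by_cases ht2 : t = (2, 2)
  · subst ht2
    simp [hs2, hC s ⟨hs0, hs2⟩]
  by_cases hst : s = t
  · subst hst
    simp [hs0, hs2, hconst s ⟨hs0, hs2⟩, hβ]
  · simp [hst, (hmid s t ⟨hs0, hs2⟩ ⟨ht0, ht2⟩ hst).1]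

/-- for 0 < c < 1/11, the state diag(a, b, b, b, b, b, b, b, c) with
a = (4−11c+7√(8c−7c²))/32 and b = (4−3c−√(8c−7c²))/32 is extreme in AP_{3,3}. -/
theorem nu171_extreme (c : ℝ) (h1 : 0 < c) (h2 : c < 1 / 11) :
    diag9 ![(4 - 11 * c + 7 * Real.sqrt (8 * c - 7 * c ^ 2)) / 32,
        (4 - 3 * c - Real.sqrt (8 * c - 7 * c ^ 2)) / 32,
        (4 - 3 * c - Real.sqrt (8 * c - 7 * c ^ 2)) / 32,
        (4 - 3 * c - Real.sqrt (8 * c - 7 * c ^ 2)) / 32,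
        (4 - 3 * c - Real.sqrt (8 * c - 7 * c ^ 2)) / 32,
        (4 - 3 * c - Real.sqrt (8 * c - 7 * c ^ 2)) / 32,
        (4 - 3 * c - Real.sqrt (8 * c - 7 * c ^ 2)) / 32,
        (4 - 3 * c - Real.sqrt (8 * c - 7 * c ^ 2)) / 32, c]
      ∈ Set.extremePoints ℝ AP33 := by
  set s := Real.sqrt (8 * c - 7 * c ^ 2)
  have hs0 : 0 ≤ s := Real.sqrt_nonneg _
  have hs2 : s ^ 2 = 8 * c - 7 * c ^ 2 := Real.sq_sqrt (by nlinarith)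
  have hcs : c < s := lt_of_pow_lt_pow_left₀ 2 hs0 (by nlinarith)
  have hsb : s < 4 - 35 * c := lt_of_pow_lt_pow_left₀ 2 (by linarith) (by nlinarith)
  rw [diag9_eq_threeLevel, mem_extremePoints_iff_left]
  have htr : (4 - 11 * c + 7 * s) / 32 + 7 * ((4 - 3 * c - s) / 32) + c = 1 := by ring
  have hdisc : ((4 - 11 * c + 7 * s) / 32 - (4 - 3 * c - s) / 32) ^ 2 =
      4 * ((4 - 3 * c - s) / 32) * c := by
    linear_combination hs2 / 16
  refine ⟨threeLevel_mem_AP33 h1.le (by linarith) (by linarith) htr hdisc.le,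
    fun r hr r' hr' hρ => ?_⟩
  exact eq_threeLevel_of_mem_openSegment (by linarith) (by linarith) htr hdisc hr hr' hρ
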